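/- arXiv:2601.08253 — 2 statements merged into one kernel-verified Lean document; each statement's English description precedes it below -/
import Mathlib

section
/- Let m, n be positive integers and σ > 0. Let W be a random real m×n matrix whose entries are independent centered Gaussian random variables with variance σ², and set S = WWᵀ. Then E[tr(S³)] = σ⁶ · n m · (n² + m² + 3nm + 3n + 3m + 4). -/
open Matrix MeasureTheory ProbabilityTheory

/-- The law of a random real `m × n` matrix with i.i.d. centered Gaussian entries of
variance `σ²`: the product over all entries of the Gaussian measure `N(0, σ²)` on `ℝ`. -/
noncomputable def gaussianMatrixMeasure (m n : ℕ) (σ : ℝ) :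
    Measure (Fin m → Fin n → ℝ) :=
  Measure.pi fun _ => Measure.pi fun _ => gaussianReal 0 ⟨σ ^ 2, sq_nonneg σ⟩

open MvPolynomial in
noncomputable def ev {m n : ℕ} (W : Fin m → Fin n → ℝ) (f : MvPolynomial (Fin m × Fin n) ℝ) : ℝ :=
  MvPolynomial.eval (fun p => W p.1 p.2) f

theorem gm_pow_integrable (v : NNReal) (k : ℕ) :
    Integrable (fun x : ℝ => x ^ k) (gaussianReal 0 v) := by
  have h := (memLp_id_gaussianReal (μ := 0) (v := v) k)
  have := h.integrable_norm_pow'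
  refine this.mono' (by fun_prop) (ae_of_all _ fun x => ?_)
  simp

theorem gm_rec (v : NNReal) (hv : v ≠ 0) (k : ℕ) :
    ∫ x, x ^ (k + 1) ∂(gaussianReal 0 v) = v * (k * ∫ x, x ^ (k - 1) ∂(gaussianReal 0 v)) := by
  have hv' : (v : ℝ) ≠ 0 := by exact_mod_cast hv
  have hint : ∀ j : ℕ, Integrable (fun x : ℝ => x ^ j * gaussianPDFReal 0 v x) := by
    intro j
    have h := gm_pow_integrable v j
    rw [gaussianReal_of_var_ne_zero _ hv,
      integrable_withDensity_iff (measurable_gaussianPDF 0 v)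
        (ae_of_all _ fun x => by simp [gaussianPDF])] at h
    simpa [toReal_gaussianPDF] using h
  have hd : ∀ x, HasDerivAt (gaussianPDFReal 0 v) (-(x / v) * gaussianPDFReal 0 v x) x := by
    intro x
    unfold gaussianPDFReal
    have h1 : HasDerivAt (fun x : ℝ => -(x - 0) ^ 2 / (2 * (v : ℝ))) (-(x / v)) x := by
      have := ((((hasDerivAt_id x).sub_const 0).pow 2).neg).div_const (2 * (v : ℝ))
      refine this.congr_deriv ?_
      simp
      field_simp
    refine (h1.exp.const_mul _).congr_deriv ?_
    ring
  have key := integral_mul_deriv_eq_deriv_mul_of_integrable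
    (u := fun x : ℝ => x ^ k) (v := gaussianPDFReal 0 v)
    (u' := fun x => k * x ^ (k - 1)) (v' := fun x => -(x / v) * gaussianPDFReal 0 v x)
    (fun x _ => hasDerivAt_pow k x) (fun x _ => hd x)
    (by
      refine ((hint (k + 1)).const_mul (-(1 / (v : ℝ)))).congr (ae_of_all _ fun x => ?_)
      simp only [Pi.mul_apply]; ring)
    (by
      refine ((hint (k - 1)).const_mul (k : ℝ)).congr (ae_of_all _ fun x => ?_)
      simp only [Pi.mul_apply]; ring)
    (hint k)
  rw [integral_gaussianReal_eq_integral_smul hv, integral_gaussianReal_eq_integral_smul hv]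
  have e1 : ∫ x : ℝ, x ^ k * (-(x / v) * gaussianPDFReal 0 v x)
      = -(1 / (v : ℝ)) * ∫ x, gaussianPDFReal 0 v x • x ^ (k + 1) := by
    rw [← integral_const_mul]; congr 1; ext x; simp only [smul_eq_mul]; ring
  have e2 : ∫ x : ℝ, k * x ^ (k - 1) * gaussianPDFReal 0 v x
      = k * ∫ x, gaussianPDFReal 0 v x • x ^ (k - 1) := by
    rw [← integral_const_mul]; congr 1; ext x; simp only [smul_eq_mul]; ring
  rw [e1, e2] at key
  field_simp at key
  linarith

section
variable {m n : ℕ} {σ : ℝ}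

theorem ev_monomial (W : Fin m → Fin n → ℝ) (c : Fin m × Fin n →₀ ℕ) (a : ℝ) :
    ev W (MvPolynomial.monomial c a) = a * ∏ i, ∏ j, W i j ^ c (i, j) := by
  rw [ev, MvPolynomial.eval_monomial, Finsupp.prod_fintype _ _ (by simp), Fintype.prod_prod_type]

/-- The entry variance as a nonnegative real. -/
noncomputable def gv (σ : ℝ) : NNReal := Real.toNNReal (σ ^ 2)

theorem gv_coe (σ : ℝ) : (gv σ : ℝ) = σ ^ 2 := Real.coe_toNNReal _ (sq_nonneg σ)

theorem gm_eq (m n : ℕ) (σ : ℝ) : gaussianMatrixMeasure m n σ =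
    Measure.pi fun _ : Fin m => Measure.pi fun _ : Fin n => gaussianReal 0 (gv σ) := by
  have h : gv σ = ⟨σ ^ 2, sq_nonneg σ⟩ := NNReal.eq (gv_coe σ)
  rw [h]
  rfl

instance : IsProbabilityMeasure (gaussianMatrixMeasure m n σ) := by
  rw [gm_eq]; infer_instance

theorem ev_integrable (f : MvPolynomial (Fin m × Fin n) ℝ) :
    Integrable (fun W => ev W f) (gaussianMatrixMeasure m n σ) := by
  induction f using MvPolynomial.induction_on' with
  | monomial c a =>
    simp only [ev_monomial]
    refine Integrable.const_mul ?_ a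
    rw [gm_eq]
    exact Integrable.fintype_prod (f := fun i (w : Fin n → ℝ) => ∏ j, w j ^ c (i, j)) fun i =>
      Integrable.fintype_prod (f := fun j (x : ℝ) => x ^ c (i, j)) fun j => gm_pow_integrable _ _
  | add p q hp hq => 
    refine (hp.add hq).congr (ae_of_all _ fun W => ?_)
    simp [ev]

theorem ev_integral_monomial (c : Fin m × Fin n →₀ ℕ) (a : ℝ) :
    ∫ W, ev W (MvPolynomial.monomial c a) ∂(gaussianMatrixMeasure m n σ) =
      a * ∏ p, ∫ x, x ^ c p ∂(gaussianReal 0 (gv σ)) := by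
  simp only [ev_monomial, integral_const_mul]
  rw [gm_eq,
    integral_fintype_prod_eq_prod (f := fun i (w : Fin n → ℝ) => ∏ j, w j ^ c (i, j)),
    Fintype.prod_prod_type]
  congr 2; ext i
  rw [integral_fintype_prod_eq_prod (f := fun j (x : ℝ) => x ^ c (i, j))]

theorem ev_stein (hσ : 0 < σ) (p : Fin m × Fin n) (f : MvPolynomial (Fin m × Fin n) ℝ) :
    ∫ W, ev W (MvPolynomial.X p * f) ∂(gaussianMatrixMeasure m n σ) =
      σ ^ 2 * ∫ W, ev W (MvPolynomial.pderiv p f) ∂(gaussianMatrixMeasure m n σ) := by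
  induction f using MvPolynomial.induction_on' with
  | monomial c a =>
    rw [MvPolynomial.X, MvPolynomial.monomial_mul, MvPolynomial.pderiv_monomial,
      ev_integral_monomial, ev_integral_monomial,
      ← Finset.mul_prod_erase _ _ (Finset.mem_univ p),
      ← Finset.mul_prod_erase (a := p) _ (fun q => ∫ x : ℝ, x ^ ((c - Finsupp.single p 1 : Fin m × Fin n →₀ ℕ) q) ∂(gaussianReal 0 (gv σ)))
        (Finset.mem_univ p)]
    have h : ∀ q ∈ Finset.univ.erase p, (Finsupp.single p 1 + c : Fin m × Fin n →₀ ℕ) q = (c - Finsupp.single p 1 : Fin m × Fin n →₀ ℕ) q := by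
      intro q hq
      have : p ≠ q := (Finset.ne_of_mem_erase hq).symm
      simp [Finsupp.single_apply, this]
    rw [Finset.prod_congr rfl fun q hq => by rw [h q hq]]
    have hv : gv σ ≠ 0 := by
      intro h0
      have := congrArg NNReal.toReal h0
      rw [gv_coe] at this
      exact (pow_pos hσ 2).ne' this
    have h2 : (Finsupp.single p 1 + c : Fin m × Fin n →₀ ℕ) p = c p + 1 := by simp [add_comm]
    have h3 : (c - Finsupp.single p 1 : Fin m × Fin n →₀ ℕ) p = c p - 1 := by simp
    rw [h2, h3, gm_rec _ hv, gv_coe]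
    ring
  | add q r hq hr =>
    have e : ∀ f g : MvPolynomial (Fin m × Fin n) ℝ,
        ∫ W, ev W (f + g) ∂(gaussianMatrixMeasure m n σ) =
        ∫ W, ev W f ∂(gaussianMatrixMeasure m n σ) + ∫ W, ev W g ∂(gaussianMatrixMeasure m n σ) := by
      intro f g
      rw [← integral_add (ev_integrable f) (ev_integrable g)]
      simp [ev]
    rw [mul_add, e, hq, hr, map_add, e, mul_add]
end

section
variable {m n : ℕ} {σ : ℝ}

/-- Expectation of a polynomial in the entries, as a linear functional. -/
noncomputable def polyE (m n : ℕ) (σ : ℝ) : MvPolynomial (Fin m × Fin n) ℝ →ₗ[ℝ] ℝ where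
  toFun f := ∫ W, ev W f ∂(gaussianMatrixMeasure m n σ)
  map_add' f g := by
    rw [← integral_add (ev_integrable f) (ev_integrable g)]
    simp [ev]
  map_smul' a f := by
    simp [ev, integral_const_mul]

/-- Kronecker delta. -/
def kd {α : Type*} [DecidableEq α] (p q : α) : ℝ := if p = q then 1 else 0

theorem kd_prod {α β : Type*} [DecidableEq α] [DecidableEq β] (a b : α) (c d : β) :
    kd (a, c) (b, d) = kd a b * kd c d := by
  simp only [kd, Prod.mk.injEq]
  split_ifs <;> simp_all

theorem polyE_one : polyE m n σ 1 = 1 := by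
  simp [polyE, ev]

theorem polyE_stein (hσ : 0 < σ) (p : Fin m × Fin n) (f : MvPolynomial (Fin m × Fin n) ℝ) :
    polyE m n σ (MvPolynomial.X p * f) = σ ^ 2 * polyE m n σ (MvPolynomial.pderiv p f) :=
  ev_stein hσ p f

theorem pderiv_kd (p q : Fin m × Fin n) :
    MvPolynomial.pderiv p (MvPolynomial.X q : MvPolynomial (Fin m × Fin n) ℝ)
      = MvPolynomial.C (kd p q) := by
  rw [MvPolynomial.pderiv_X, kd, Pi.single_apply]
  by_cases h : p = q
  · simp [h]
  · simp [h, Ne.symm h]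

open MvPolynomial in
theorem wick2 (hσ : 0 < σ) (p q : Fin m × Fin n) :
    polyE m n σ (X p * X q) = σ ^ 2 * kd p q := by
  rw [polyE_stein hσ, pderiv_kd, ← mul_one (C _), ← smul_eq_C_mul, map_smul, polyE_one]
  simp

open MvPolynomial in
theorem wick4 (hσ : 0 < σ) (p q r s : Fin m × Fin n) :
    polyE m n σ (X p * (X q * (X r * X s))) =
      σ ^ 4 * (kd p q * kd r s + kd p r * kd q s + kd p s * kd q r) := by
  have h : pderiv p (X q * (X r * X s) : MvPolynomial (Fin m × Fin n) ℝ) =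
      kd p q • (X r * X s) + kd p r • (X q * X s) + kd p s • (X q * X r) := by
    simp only [pderiv_mul, pderiv_kd, smul_eq_C_mul]; ring
  rw [polyE_stein hσ, h]
  simp only [map_add, map_smul, wick2 hσ, smul_eq_mul]
  ring

open MvPolynomial in
theorem wick6 (hσ : 0 < σ) (p q r s t u : Fin m × Fin n) :
    polyE m n σ (X p * (X q * (X r * (X s * (X t * X u))))) =
      σ ^ 6 * (kd p q * (kd r s * kd t u + kd r t * kd s u + kd r u * kd s t)
        + kd p r * (kd q s * kd t u + kd q t * kd s u + kd q u * kd s t)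
        + kd p s * (kd q r * kd t u + kd q t * kd r u + kd q u * kd r t)
        + kd p t * (kd q r * kd s u + kd q s * kd r u + kd q u * kd r s)
        + kd p u * (kd q r * kd s t + kd q s * kd r t + kd q t * kd r s)) := by
  have h : pderiv p (X q * (X r * (X s * (X t * X u))) : MvPolynomial (Fin m × Fin n) ℝ) =
      kd p q • (X r * (X s * (X t * X u))) + kd p r • (X q * (X s * (X t * X u)))
      + kd p s • (X q * (X r * (X t * X u))) + kd p t • (X q * (X r * (X s * X u)))
      + kd p u • (X q * (X r * (X s * X t))) := by
    simp only [pderiv_mul, pderiv_kd, smul_eq_C_mul]; ring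
  rw [polyE_stein hσ, h]
  simp only [map_add, map_smul, wick4 hσ, smul_eq_mul]
  ring

open MvPolynomial in
theorem trace_eq_ev (W : Fin m → Fin n → ℝ) :
    ((Matrix.of W * (Matrix.of W)ᵀ) ^ 3).trace =
      ev W (∑ i : Fin m, ∑ j : Fin m, ∑ k : Fin m, ∑ a : Fin n, ∑ b : Fin n, ∑ c : Fin n,
        X (i, a) * (X (j, a) * (X (j, b) * (X (k, b) * (X (k, c) * X (i, c)))))) := by
  have h : ((Matrix.of W * (Matrix.of W)ᵀ) ^ 3).trace =
      ∑ i, ∑ j, ∑ k, (∑ a, W i a * W j a) * ((∑ b, W j b * W k b) * ∑ c, W k c * W i c) := by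
    rw [pow_succ', pow_two]
    simp only [Matrix.trace, Matrix.diag, Matrix.mul_apply, Matrix.transpose_apply,
      Matrix.of_apply]
    simp only [Finset.mul_sum]
  rw [h]
  simp only [ev, map_sum, map_mul, eval_X]
  refine Finset.sum_congr rfl fun i _ => Finset.sum_congr rfl fun j _ =>
    Finset.sum_congr rfl fun k _ => ?_
  rw [Finset.sum_mul]
  refine Finset.sum_congr rfl fun a _ => ?_
  rw [Finset.sum_mul, Finset.mul_sum]
  refine Finset.sum_congr rfl fun b _ => ?_
  rw [Finset.mul_sum, Finset.mul_sum]
  refine Finset.sum_congr rfl fun c _ => ?_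
  ring

theorem delta_sum (m n : ℕ) :
    ∑ i : Fin m, ∑ j : Fin m, ∑ k : Fin m, ∑ a : Fin n, ∑ b : Fin n, ∑ c : Fin n,
      (kd (i, a) (j, a) * (kd (j, b) (k, b) * kd (k, c) (i, c)
          + kd (j, b) (k, c) * kd (k, b) (i, c) + kd (j, b) (i, c) * kd (k, b) (k, c))
        + kd (i, a) (j, b) * (kd (j, a) (k, b) * kd (k, c) (i, c)
          + kd (j, a) (k, c) * kd (k, b) (i, c) + kd (j, a) (i, c) * kd (k, b) (k, c))
        + kd (i, a) (k, b) * (kd (j, a) (j, b) * kd (k, c) (i, c)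
          + kd (j, a) (k, c) * kd (j, b) (i, c) + kd (j, a) (i, c) * kd (j, b) (k, c))
        + kd (i, a) (k, c) * (kd (j, a) (j, b) * kd (k, b) (i, c)
          + kd (j, a) (k, b) * kd (j, b) (i, c) + kd (j, a) (i, c) * kd (j, b) (k, b))
        + kd (i, a) (i, c) * (kd (j, a) (j, b) * kd (k, b) (k, c)
          + kd (j, a) (k, b) * kd (j, b) (k, c) + kd (j, a) (k, c) * kd (j, b) (k, b)))
      = ((n : ℝ) * m) *
        ((n : ℝ) ^ 2 + (m : ℝ) ^ 2 + 3 * n * m + 3 * n + 3 * m + 4) := by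
  simp only [kd_prod, mul_add, Finset.sum_add_distrib]
  simp [kd, Finset.sum_ite_irrel, ite_mul, mul_ite]
  ring
end

/-- With `W` a random real `m × n` matrix with i.i.d. centered Gaussian
entries of variance `σ²` and `S = W Wᵀ`, one has
`E[tr (S³)] = σ⁶ n m (n² + m² + 3 n m + 3 n + 3 m + 4)`. -/
theorem stmt_11 (m n : ℕ) (hm : 0 < m) (hn : 0 < n) (σ : ℝ) (hσ : 0 < σ) :
    ∫ W : Fin m → Fin n → ℝ, ((Matrix.of W * (Matrix.of W)ᵀ) ^ 3).trace
        ∂(gaussianMatrixMeasure m n σ) =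
      σ ^ 6 * ((n : ℝ) * m) *
        ((n : ℝ) ^ 2 + (m : ℝ) ^ 2 + 3 * n * m + 3 * n + 3 * m + 4) := by
  simp only [trace_eq_ev]
  change polyE m n σ _ = _
  simp only [map_sum, wick6 hσ]
  simp only [← Finset.mul_sum]
  rw [delta_sum]
  ring
end

section
/- Let m, n be positive integers with n ≥ m, let α > 0, and let μ be the product measure on real m×n matrices under which the entries are i.i.d. standard centered Gaussians (variance 1). Then lim_{σ → ∞} ∫ tr((αIₘ + σ² · WWᵀ)⁻¹) dμ(W) = 0. -/
open Matrix MeasureTheory ProbabilityTheory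

lemma pi_ac {n : ℕ} (μ ν : Measure ℝ) [SigmaFinite μ] [SigmaFinite ν] (h : μ ≪ ν) :
    (Measure.pi fun _ : Fin n => μ) ≪ Measure.pi fun _ : Fin n => ν := by
  induction n with
  | zero =>
    rw [Measure.pi_of_empty, Measure.pi_of_empty]
  | succ k ih =>
    have h1 := (measurePreserving_piFinSuccAbove (fun _ : Fin (k+1) => μ) 0).symm
    have h2 := (measurePreserving_piFinSuccAbove (fun _ : Fin (k+1) => ν) 0).symm
    rw [← h1.map_eq, ← h2.map_eq]
    exact (h.prod ih).map h1.measurable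

lemma ae_linInd {n : ℕ} (ρ : Measure (Fin n → ℝ)) [SigmaFinite ρ] (hρ : ρ ≪ volume)
    (k : ℕ) (hk : k ≤ n) :
    ∀ᵐ W : Fin k → Fin n → ℝ ∂(Measure.pi fun _ => ρ), LinearIndependent ℝ W := by
  induction k with
  | zero => exact Filter.Eventually.of_forall fun W => linearIndependent_empty_type
  | succ k ih =>
    have h1 := (measurePreserving_piFinSuccAbove (fun _ : Fin (k+1) => ρ) 0).symm
    rw [← h1.map_eq]
    have hmeas : MeasurableSet {W : Fin (k+1) → Fin n → ℝ | LinearIndependent ℝ W} :=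
      isOpen_setOfPred_linearIndependent.measurableSet
    rw [ae_map_iff h1.measurable.aemeasurable hmeas]
    have hsw : ∀ᵐ z : (Fin k → Fin n → ℝ) × (Fin n → ℝ)
        ∂((Measure.pi fun _ : Fin k => ρ).prod ρ),
        LinearIndependent ℝ (Fin.cons z.2 z.1 : Fin (k+1) → Fin n → ℝ) := by
      rw [Measure.ae_prod_iff_ae_ae]
      · filter_upwards [ih (by omega)] with W hW
        have hne : Submodule.span ℝ (Set.range W) ≠ ⊤ := by
          intro h
          have := finrank_range_le_card (R := ℝ) W
          rw [Set.finrank, h, finrank_top] at this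
          simp at this
          omega
        have := hρ (Measure.addHaar_submodule volume _ hne)
        have h3 : ∀ᵐ x ∂ρ, x ∉ Submodule.span ℝ (Set.range W) := by
          rw [ae_iff]; simpa using this
        filter_upwards [h3] with x hx
        exact linearIndependent_finCons.2 ⟨hW, hx⟩
      · have hc : Measurable fun z : (Fin k → Fin n → ℝ) × (Fin n → ℝ) =>
            (Fin.cons z.2 z.1 : Fin (k+1) → Fin n → ℝ) := by
          refine measurable_pi_lambda _ fun i => ?_
          refine Fin.cases ?_ (fun j => ?_) i
          · simpa using measurable_snd
          · simp only [Fin.cons_succ]; fun_prop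
        exact hc hmeas
    have := (Measure.measurePreserving_swap (μ := ρ)
      (ν := Measure.pi fun _ : Fin k => ρ)).quasiMeasurePreserving.ae hsw
    filter_upwards [this] with z hz
    have e : (MeasurableEquiv.piFinSuccAbove (fun _ : Fin (k+1) => (Fin n → ℝ)) 0).symm z
        = (Fin.cons z.1 z.2 : Fin (k+1) → Fin n → ℝ) := by
      simp [MeasurableEquiv.piFinSuccAbove, Fin.insertNthEquiv]
    rw [e]; exact hz

lemma posDef_A {m n : ℕ} (α : ℝ) (hα : 0 < α) (σ : ℝ) (W : Matrix (Fin m) (Fin n) ℝ) :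
    (α • (1 : Matrix (Fin m) (Fin m) ℝ) + σ ^ 2 • (W * Wᵀ)).PosDef := by
  refine (Matrix.PosDef.one.smul hα).add_posSemidef ?_
  have := (Matrix.posSemidef_self_mul_conjTranspose W).smul (sq_nonneg σ)
  simpa [Matrix.conjTranspose_eq_transpose_of_trivial] using this

lemma diag_bound {m n : ℕ} (α : ℝ) (hα : 0 < α) (σ : ℝ) (W : Matrix (Fin m) (Fin n) ℝ)
    (i : Fin m) :
    |(α • (1 : Matrix (Fin m) (Fin m) ℝ) + σ ^ 2 • (W * Wᵀ))⁻¹ i i| ≤ 1 / α := by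
  have hP := posDef_A α hα σ W
  set A := α • (1 : Matrix (Fin m) (Fin m) ℝ) + σ ^ 2 • (W * Wᵀ) with hA
  have hu : IsUnit A.det := (Matrix.isUnit_iff_isUnit_det A).1 hP.isUnit
  set x := A⁻¹ *ᵥ Pi.single i 1 with hx
  have hxi : A⁻¹ i i = x i := by simp [hx]
  have hAx : A *ᵥ x = Pi.single i 1 := by
    rw [hx, Matrix.mulVec_mulVec, Matrix.mul_nonsing_inv _ hu, Matrix.one_mulVec]
  have h1 : x ⬝ᵥ (A *ᵥ x) = x i := by rw [hAx]; simp
  have h2 : x ⬝ᵥ (A *ᵥ x) = α * (x ⬝ᵥ x) + σ ^ 2 * ((Wᵀ *ᵥ x) ⬝ᵥ (Wᵀ *ᵥ x)) := by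
    rw [hA, Matrix.add_mulVec, Matrix.smul_mulVec, Matrix.smul_mulVec, Matrix.one_mulVec,
      dotProduct_add, dotProduct_smul, dotProduct_smul, ← Matrix.mulVec_mulVec,
      Matrix.dotProduct_mulVec x W, ← Matrix.mulVec_transpose]
    simp only [smul_eq_mul]
  have h3 : 0 ≤ (Wᵀ *ᵥ x) ⬝ᵥ (Wᵀ *ᵥ x) := by
    rw [dotProduct]; exact Finset.sum_nonneg fun j _ => mul_self_nonneg _
  have h4 : x i * x i ≤ x ⬝ᵥ x := by
    rw [dotProduct]
    exact Finset.single_le_sum (f := fun j => x j * x j)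
      (fun j _ => mul_self_nonneg _) (Finset.mem_univ i)
  have h5 : α * (x i * x i) ≤ x i := by
    nlinarith [mul_nonneg (sq_nonneg σ) h3, mul_le_mul_of_nonneg_left h4 hα.le]
  have h6 : 0 ≤ x i := le_trans (mul_nonneg hα.le (mul_self_nonneg _)) h5
  rw [hxi, abs_of_nonneg h6, le_div_iff₀ hα]
  by_contra! hc
  nlinarith

lemma tendsto_trace {m n : ℕ} (α : ℝ) (W : Matrix (Fin m) (Fin n) ℝ)
    (hW : LinearIndependent ℝ W.row) :
    Filter.Tendsto (fun σ : ℝ => ((α • (1 : Matrix (Fin m) (Fin m) ℝ) +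
      σ ^ 2 • (W * Wᵀ))⁻¹).trace) Filter.atTop (nhds 0) := by
  have hB : (W * Wᵀ).PosDef := by
    have := Matrix.PosDef.mul_conjTranspose_self W (Matrix.vecMul_injective_iff.2 hW)
    simpa [Matrix.conjTranspose_eq_transpose_of_trivial] using this
  set B := W * Wᵀ
  have hd : B.det ≠ 0 := hB.det_pos.ne'
  let g : ℝ → ℝ := fun t => t * ((((t * α) • (1 : Matrix (Fin m) (Fin m) ℝ) + B)).det⁻¹
    * ((t * α) • (1 : Matrix (Fin m) (Fin m) ℝ) + B).adjugate.trace)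
  have hg : ContinuousAt g 0 := by
    have hc : Continuous fun t : ℝ => (t * α) • (1 : Matrix (Fin m) (Fin m) ℝ) + B := by fun_prop
    refine continuousAt_id.mul (ContinuousAt.mul (ContinuousAt.inv₀ ?_ ?_) ?_)
    · exact hc.matrix_det.continuousAt
    · simpa using hd
    · exact hc.matrix_adjugate.matrix_trace.continuousAt
  have hg0 : Filter.Tendsto g (nhds 0) (nhds 0) := by
    have := hg.tendsto
    simpa [g] using this
  have ht : Filter.Tendsto (fun σ : ℝ => (σ ^ 2)⁻¹) Filter.atTop (nhds 0) :=
    (Filter.tendsto_pow_atTop (by norm_num)).inv_tendsto_atTop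
  refine (hg0.comp ht).congr' ?_
  filter_upwards [Filter.eventually_gt_atTop 0] with σ hσ
  have h2 : σ ^ 2 ≠ 0 := by positivity
  have e : α • (1 : Matrix (Fin m) (Fin m) ℝ) + σ ^ 2 • B
      = σ ^ 2 • (((σ ^ 2)⁻¹ * α) • (1 : Matrix (Fin m) (Fin m) ℝ) + B) := by
    rw [smul_add, smul_smul, mul_inv_cancel_left₀ h2]
  have e2 : ∀ C : Matrix (Fin m) (Fin m) ℝ, (σ ^ 2 • C)⁻¹ = (σ ^ 2)⁻¹ • C⁻¹ := by
    intro C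
    by_cases hC : IsUnit C.det
    · exact Matrix.inv_smul' C (Units.mk0 _ h2) hC
    · rw [Matrix.nonsing_inv_apply_not_isUnit C hC, smul_zero,
        Matrix.nonsing_inv_apply_not_isUnit]
      rw [Matrix.det_smul]
      intro h
      exact hC (isUnit_of_mul_isUnit_right h)
  simp only [Function.comp, g]
  rw [e, e2, Matrix.trace_smul, Matrix.inv_def, Matrix.trace_smul, Ring.inverse_eq_inv']
  simp

/-- Let `n ≥ m`, `α > 0`, and let `μ` be the law of an `m × n` matrix with
i.i.d. standard centered Gaussian entries (variance 1). Then
`lim_{σ → ∞} ∫ tr ((α Iₘ + σ² W Wᵀ)⁻¹) dμ(W) = 0`. -/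
theorem stmt_15 (m n : ℕ) (hm : 0 < m) (hn : 0 < n) (hnm : n ≥ m)
    (α : ℝ) (hα : 0 < α) :
    Filter.Tendsto
      (fun σ : ℝ => ∫ W : Fin m → Fin n → ℝ,
        ((α • (1 : Matrix (Fin m) (Fin m) ℝ) +
            σ ^ 2 • (Matrix.of W * (Matrix.of W)ᵀ))⁻¹).trace
          ∂(gaussianMatrixMeasure m n 1))
      Filter.atTop (nhds 0) := by
  have hgm : gaussianMatrixMeasure m n 1
      = Measure.pi fun _ => Measure.pi fun _ => gaussianReal 0 1 := by
    have h1 : (⟨1 ^ 2, sq_nonneg 1⟩ : NNReal) = 1 := by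
      apply NNReal.eq; exact one_pow 2
    unfold gaussianMatrixMeasure
    exact congrArg (fun v : NNReal => (Measure.pi fun _ : Fin m => Measure.pi fun _ : Fin n =>
      gaussianReal 0 v)) h1
  rw [hgm]
  have hae : ∀ᵐ W ∂(Measure.pi fun _ : Fin m => Measure.pi fun _ : Fin n => gaussianReal 0 1), LinearIndependent ℝ W := by
    refine ae_linInd _ ?_ m hnm
    refine pi_ac _ volume (gaussianReal_absolutelyContinuous 0 one_ne_zero)
  have hprob : IsProbabilityMeasure
      (Measure.pi fun _ : Fin m => Measure.pi fun _ : Fin n => gaussianReal 0 1) := inferInstance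
  generalize (Measure.pi fun _ : Fin m => Measure.pi fun _ : Fin n => gaussianReal 0 1) = μ
    at hae hprob ⊢
  rw [show (0 : ℝ) = ∫ W : Fin m → Fin n → ℝ, (0 : ℝ) ∂μ by simp]
  refine tendsto_integral_filter_of_dominated_convergence (fun _ => ∑ _i : Fin m, 1 / α) ?_ ?_
    (integrable_const _) ?_
  · refine Filter.Eventually.of_forall fun σ => Continuous.aestronglyMeasurable ?_
    have hc : Continuous fun W : Fin m → Fin n → ℝ => (α • (1 : Matrix (Fin m) (Fin m) ℝ) +
            σ ^ 2 • (Matrix.of W * (Matrix.of W)ᵀ)) := by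
      have : Continuous fun W : Fin m → Fin n → ℝ => (Matrix.of W : Matrix (Fin m) (Fin n) ℝ) :=
        continuous_id
      have h2 := this.matrix_mul this.matrix_transpose
      fun_prop
    simp only [Matrix.inv_def, Ring.inverse_eq_inv', Matrix.trace_smul]
    refine Continuous.smul (hc.matrix_det.inv₀ fun W => ?_) hc.matrix_adjugate.matrix_trace
    exact (posDef_A α hα σ (Matrix.of W)).det_pos.ne'
  · refine Filter.Eventually.of_forall fun σ => Filter.Eventually.of_forall fun W => ?_
    rw [Matrix.trace, Real.norm_eq_abs]
    refine (Finset.abs_sum_le_sum_abs _ _).trans (Finset.sum_le_sum fun i _ => ?_)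
    exact diag_bound α hα σ (Matrix.of W) i
  · filter_upwards [hae] with W hW
    exact tendsto_trace α (Matrix.of W) hW
end
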